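/- Let φ, ϕ ∈ (0, π), σ_φ, σ_ϕ > 0, and let M_t be a fixed positive integer. Let ω_φ and ω_ϕ be independent real Gaussian random variables with mean 0 and variances σ_φ², σ_ϕ², and let F_M denote the Fejér kernel F_M(x) = (1/M)·(sin(Mπx/2)/sin(πx/2))² for x not an even integer, F_M(x) = M otherwise. Then ( lim_{L_x→∞} E[ F_{L_x}( cos(φ + ω_φ) − cos φ ) · F_{M_t}( cos(φ + ω_φ) − cos φ ) ] ) · ( lim_{L_y→∞} E[ F_{L_y}( cos(ϕ + ω_ϕ) − cos ϕ ) ] ) = 4 · M_t · h(φ, σ_φ²) · h(ϕ, σ_ϕ²), where h(x, y) = (1/√(2π·y·sin²x)) · ∑_{i ∈ ℤ} ( exp(−2(iπ)²/y) + exp(−2((i+1)π − x)²/y) ). -/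

import Mathlib

open MeasureTheory ProbabilityTheory Filter
open scoped Classical

/-- The Fejér kernel: `F_M(x) = (1/M)·(sin(Mπx/2)/sin(πx/2))²` for `x` not an even
integer, and `F_M(x) = M` for `x` an even integer. -/
noncomputable def fejer (M : ℕ) (x : ℝ) : ℝ :=
  if ∃ k : ℤ, x = 2 * k then (M : ℝ)
  else (1 / M) * (Real.sin (M * Real.pi * x / 2) / Real.sin (Real.pi * x / 2)) ^ 2

/-- The wrapped-Gaussian factor `h(x, y)` of the paper. -/
noncomputable def hfun (x y : ℝ) : ℝ :=
  (1 / Real.sqrt (2 * Real.pi * y * (Real.sin x) ^ 2)) *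
    ∑' i : ℤ, (Real.exp (-2 * ((i : ℝ) * Real.pi) ^ 2 / y) +
      Real.exp (-2 * (((i : ℝ) + 1) * Real.pi - x) ^ 2 / y))

lemma sin_mul_dirichlet (t : ℝ) (m : ℕ) :
    Real.sin t * (1 + 2 * ∑ k ∈ Finset.range m, Real.cos (2 * ((k + 1 : ℕ) : ℝ) * t)) =
      Real.sin ((2 * m + 1) * t) := by
  induction m with
  | zero => simp
  | succ m ih =>
    rw [Finset.sum_range_succ]
    have e1 : (2 * (m : ℝ) + 1) * t = 2 * ((m + 1 : ℕ) : ℝ) * t - t := by push_cast; ring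
    have e2 : (2 * ((m + 1 : ℕ) : ℝ) + 1) * t = 2 * ((m + 1 : ℕ) : ℝ) * t + t := by
      push_cast; ring
    rw [e2, Real.sin_add]
    rw [e1, Real.sin_sub] at ih
    linear_combination ih

lemma sin_sq_mul_sum_dirichlet (t : ℝ) (M : ℕ) :
    Real.sin t ^ 2 * ∑ m ∈ Finset.range M,
        (1 + 2 * ∑ k ∈ Finset.range m, Real.cos (2 * ((k + 1 : ℕ) : ℝ) * t)) =
      Real.sin (M * t) ^ 2 := by
  induction M with
  | zero => simp
  | succ M ih =>
    rw [Finset.sum_range_succ, mul_add, ih]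
    have h := sin_mul_dirichlet t M
    have e1 : (2 * (M : ℝ) + 1) * t = M * t + (M * t + t) := by ring
    have e2 : ((M + 1 : ℕ) : ℝ) * t = M * t + t := by push_cast; ring
    rw [e1, Real.sin_add, Real.sin_add, Real.cos_add] at h
    rw [e2, Real.sin_add]
    linear_combination Real.sin t * h - Real.sin (M * t) ^ 2 * Real.sin_sq_add_cos_sq t

/-- The Fejér kernel as a Cesàro mean of Dirichlet kernels. -/
lemma fejer_eq_sum (M : ℕ) (x : ℝ) :
    fejer M x = (1 / M) * ∑ m ∈ Finset.range M,
      (1 + 2 * ∑ k ∈ Finset.range m, Real.cos (((k + 1 : ℕ) : ℝ) * Real.pi * x)) := by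
  have hc : ∀ k : ℕ, ((k + 1 : ℕ) : ℝ) * Real.pi * x
      = 2 * ((k + 1 : ℕ) : ℝ) * (Real.pi * x / 2) := fun k => by ring
  unfold fejer
  split_ifs with h
  · obtain ⟨k, rfl⟩ := h
    have h1 : ∀ j : ℕ, Real.cos (((j + 1 : ℕ) : ℝ) * Real.pi * (2 * (k : ℝ))) = 1 := fun j => by
      rw [show ((j + 1 : ℕ) : ℝ) * Real.pi * (2 * (k : ℝ))
        = (((j + 1 : ℕ) * k : ℤ) : ℝ) * (2 * Real.pi) by push_cast; ring]
      exact Real.cos_int_mul_two_pi _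
    have h2 : ∀ N : ℕ, ∑ m ∈ Finset.range N, (1 + 2 * (m : ℝ)) = (N : ℝ) ^ 2 := fun N => by
      induction N with
      | zero => simp
      | succ N ih => rw [Finset.sum_range_succ, ih]; push_cast; ring
    simp only [h1, Finset.sum_const, Finset.card_range, nsmul_eq_mul, mul_one, h2]
    rcases eq_or_ne (M : ℝ) 0 with h0 | h0
    · simp [h0]
    · field_simp
  · have hs : Real.sin (Real.pi * x / 2) ≠ 0 := by
      intro h0
      obtain ⟨n, hn⟩ := Real.sin_eq_zero_iff.1 h0
      refine h ⟨n, ?_⟩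
      have := Real.pi_ne_zero
      field_simp at hn
      linarith
    simp_rw [hc]
    rw [div_pow, show (M : ℝ) * Real.pi * x / 2 = M * (Real.pi * x / 2) by ring,
      ← sin_sq_mul_sum_dirichlet, mul_div_cancel_left₀ _ (pow_ne_zero 2 hs)]

lemma continuous_fejer (M : ℕ) : Continuous (fejer M) := by
  rw [funext (fejer_eq_sum M)]
  fun_prop

lemma fejer_zero_right (M : ℕ) : fejer M 0 = M := if_pos ⟨0, by simp⟩

lemma fejer_nonneg (M : ℕ) (x : ℝ) : 0 ≤ fejer M x := by
  unfold fejer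
  split_ifs <;> positivity

lemma integral_fejer {M : ℕ} (hM : M ≠ 0) (a : ℝ) : ∫ x in (a - 1)..(a + 1), fejer M x = 2 := by
  have hcos : ∀ k : ℕ,
      ∫ x in (a - 1)..(a + 1), Real.cos (((k + 1 : ℕ) : ℝ) * Real.pi * x) = 0 := fun k => by
    rw [intervalIntegral.integral_comp_mul_left _
      (mul_ne_zero (Nat.cast_ne_zero.2 k.succ_ne_zero) Real.pi_ne_zero), integral_cos,
      show ((k + 1 : ℕ) : ℝ) * Real.pi * (a + 1)
        = ((k + 1 : ℕ) : ℝ) * Real.pi * (a - 1) + (k + 1 : ℕ) * (2 * Real.pi) by ring,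
      Real.sin_add_nat_mul_two_pi]
    simp
  simp_rw [fejer_eq_sum]
  rw [intervalIntegral.integral_const_mul, intervalIntegral.integral_finsetSum
    fun i _ => Continuous.intervalIntegrable (by fun_prop) _ _]
  have hm : ∀ m : ℕ, ∫ x in (a - 1)..(a + 1),
      (1 + 2 * ∑ k ∈ Finset.range m, Real.cos (((k + 1 : ℕ) : ℝ) * Real.pi * x)) = 2 := fun m => by
    rw [intervalIntegral.integral_add (by simp) (Continuous.intervalIntegrable (by fun_prop) _ _),
      intervalIntegral.integral_const_mul, intervalIntegral.integral_finsetSum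
        fun i _ => Continuous.intervalIntegrable (by fun_prop) _ _]
    simp only [hcos]
    simp
    norm_num
  have : (M : ℝ) ≠ 0 := Nat.cast_ne_zero.2 hM
  simp only [hm]
  simp
  field_simp

lemma fejer_le {x : ℝ} (M : ℕ) (h : Real.sin (Real.pi * x / 2) ≠ 0) :
    fejer M x ≤ (1 / M) * (1 / Real.sin (Real.pi * x / 2) ^ 2) := by
  unfold fejer
  rw [if_neg]
  · rw [div_pow]
    gcongr
    exact Real.sin_sq_le_one _
  · rintro ⟨k, rfl⟩
    apply h
    rw [show Real.pi * (2 * (k : ℝ)) / 2 = k * Real.pi by ring]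
    exact Real.sin_int_mul_pi k

/-- Away from its peak at `a`, the translated Fejér kernel tends to zero uniformly on `(-1, 1)`. -/
lemma tendstoUniformlyOn_fejer {a : ℝ} (ha : a ∈ Set.Ioo (-1 : ℝ) 1) {u : Set ℝ} (hu : IsOpen u)
    (hau : a ∈ u) :
    TendstoUniformlyOn (fun (L : ℕ) x => fejer L (x - a)) 0 atTop (Set.Ioo (-1) 1 \ u) := by
  have hK : IsCompact (Set.Icc (-1 : ℝ) 1 \ u) := isCompact_Icc.diff hu
  have hne : ∀ x ∈ Set.Icc (-1 : ℝ) 1 \ u, Real.sin (Real.pi * (x - a) / 2) ≠ 0 := by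
    rintro x ⟨hx, hxu⟩ h0
    have hp := Real.pi_pos
    rw [Real.sin_eq_zero_iff_of_lt_of_lt (by nlinarith [hx.1, ha.2]) (by nlinarith [hx.2, ha.1])]
      at h0
    have : x = a := by
      rcases (by simpa [hp.ne'] using h0 : x - a = 0) with h
      linarith
    exact hxu (this ▸ hau)
  have hcont : ContinuousOn (fun x => 1 / Real.sin (Real.pi * (x - a) / 2) ^ 2)
      (Set.Icc (-1 : ℝ) 1 \ u) :=
    ContinuousOn.div continuousOn_const (by fun_prop) fun x hx => pow_ne_zero 2 (hne x hx)
  obtain ⟨C, hC⟩ := hK.exists_bound_of_continuousOn hcont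
  have hlim : Tendsto (fun L : ℕ => (1 / (L : ℝ)) * C) atTop (nhds 0) := by
    simpa using tendsto_one_div_atTop_nhds_zero_nat.mul_const C
  rw [Metric.tendstoUniformlyOn_iff]
  intro ε hε
  filter_upwards [hlim.eventually (gt_mem_nhds hε)] with L hL x hx
  have hx' : x ∈ Set.Icc (-1 : ℝ) 1 \ u := ⟨Set.Ioo_subset_Icc_self hx.1, hx.2⟩
  rw [Pi.zero_apply, dist_zero_left, Real.norm_of_nonneg (fejer_nonneg _ _)]
  refine ((fejer_le L (hne x hx')).trans ?_).trans_lt hL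
  gcongr
  exact (le_abs_self _).trans (hC x hx')

/-- The translated Fejér kernels form an approximate identity, of mass `2`, on `(-1, 1)`. -/
lemma tendsto_integral_fejer_mul {a : ℝ} (ha : a ∈ Set.Ioo (-1 : ℝ) 1) {g : ℝ → ℝ}
    (hg : IntegrableOn g (Set.Ioo (-1) 1)) (hga : ContinuousAt g a) :
    Tendsto (fun L : ℕ => ∫ x in Set.Ioo (-1 : ℝ) 1, fejer L (x - a) * g x) atTop
      (nhds (2 * g a)) := by
  have hmass : ∀ L : ℕ, L ≠ 0 → ∫ x in Set.Ioo (-1 : ℝ) 1, fejer L (x - a) / 2 = 1 := by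
    intro L hL
    rw [integral_div, ← integral_Ioc_eq_integral_Ioo,
      ← intervalIntegral.integral_of_le (by norm_num),
      intervalIntegral.integral_comp_sub_right (fejer L) a,
      show -1 - a = -a - 1 by ring, show 1 - a = -a + 1 by ring, integral_fejer hL]
    norm_num
  have key := tendsto_setIntegral_peak_smul_of_integrableOn_of_tendsto
    (μ := volume) (s := Set.Ioo (-1 : ℝ) 1) (t := Set.Ioo (-1 : ℝ) 1) (x₀ := a) (l := atTop)
    (φ := fun (L : ℕ) x => fejer L (x - a) / 2) (g := g) (a := g a)
    measurableSet_Ioo measurableSet_Ioo le_rfl self_mem_nhdsWithin (by simp)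
    (Eventually.of_forall fun L x _ => div_nonneg (fejer_nonneg _ _) zero_le_two) ?_ ?_
    (Eventually.of_forall fun L => ?_) hg (hga.mono_left nhdsWithin_le_nhds)
  · refine (key.const_mul 2).congr fun L => ?_
    rw [← integral_const_mul]
    refine integral_congr_ae (Eventually.of_forall fun x => ?_)
    simp only [smul_eq_mul]
    ring
  · intro u hu hau
    have := tendstoUniformlyOn_fejer ha hu hau
    rw [Metric.tendstoUniformlyOn_iff] at this ⊢
    intro ε hε
    filter_upwards [this ε hε] with L hL x hx
    have := hL x hx
    have h0 := fejer_nonneg L (x - a)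
    rw [Pi.zero_apply, dist_zero_left, Real.norm_of_nonneg (by positivity)] at this ⊢
    linarith
  · refine tendsto_const_nhds.congr' ?_
    filter_upwards [eventually_ne_atTop 0] with L hL
    exact (hmass L hL).symm
  · have := continuous_fejer L
    exact Continuous.aestronglyMeasurable (by fun_prop)

lemma image_cos_Ioo_zero_pi : Real.cos '' Set.Ioo 0 Real.pi = Set.Ioo (-1) 1 := by
  ext y
  constructor
  · rintro ⟨x, hx, rfl⟩
    constructor
    · rw [← Real.cos_pi]
      exact Real.strictAntiOn_cos (Set.Ioo_subset_Icc_self hx)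
        (Set.right_mem_Icc.2 Real.pi_pos.le) hx.2
    · rw [← Real.cos_zero]
      exact Real.strictAntiOn_cos (Set.left_mem_Icc.2 Real.pi_pos.le)
        (Set.Ioo_subset_Icc_self hx) hx.1
  · rintro ⟨h1, h2⟩
    exact ⟨Real.arccos y, ⟨Real.arccos_pos.2 h2, Real.arccos_lt_pi.2 h1⟩,
      Real.cos_arccos h1.le h2.le⟩

lemma summable_exp_neg_mul_int_sq {c : ℝ} (hc : 0 < c) :
    Summable fun n : ℤ => Real.exp (-c * (n : ℝ) ^ 2) := by
  have h : Summable fun n : ℕ => Real.exp (-c * (n : ℝ) ^ 2) := by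
    refine Summable.of_nonneg_of_le (fun _ => (Real.exp_pos _).le) (fun n => ?_)
      (Real.summable_exp_nat_mul_iff.2 (neg_lt_zero.2 hc))
    have : (n : ℝ) ≤ (n : ℝ) ^ 2 := by exact_mod_cast Nat.le_self_pow two_ne_zero n
    exact Real.exp_le_exp.2 (by nlinarith)
  exact Summable.of_nat_of_neg (by simpa using h) (by simpa using h)

/-- The density of the Gaussian law `N(m, v)` wrapped around the circle of length `2π`. -/
noncomputable def wrappedPDF (m : ℝ) (v : NNReal) (x : ℝ) : ℝ :=
  ∑' n : ℤ, gaussianPDFReal m v (x + n * (2 * Real.pi))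

lemma continuous_gaussianPDFReal (m : ℝ) (v : NNReal) : Continuous (gaussianPDFReal m v) := by
  unfold gaussianPDFReal
  fun_prop

/-- Translates of the Gaussian density are dominated by a summable sequence, uniformly on
bounded sets. -/
lemma exists_summable_bound_gaussianPDFReal (m : ℝ) {v : NNReal} (hv : v ≠ 0) (R : ℝ) :
    ∃ u : ℤ → ℝ, Summable u ∧ ∀ (n : ℤ) (x : ℝ), |x| ≤ R →
      ‖gaussianPDFReal m v (x + n * (2 * Real.pi))‖ ≤ u n := by
  have hv' : (0 : ℝ) < v := NNReal.coe_pos.2 (pos_iff_ne_zero.2 hv)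
  refine ⟨fun n => (√(2 * Real.pi * v))⁻¹ * (Real.exp ((R + |m|) ^ 2 / (2 * v)) *
    Real.exp (-(Real.pi ^ 2 / v) * (n : ℝ) ^ 2)),
    ((summable_exp_neg_mul_int_sq (by positivity)).mul_left _).mul_left _, fun n x hx => ?_⟩
  beta_reduce
  rw [Real.norm_of_nonneg (gaussianPDFReal_nonneg _ _ _), gaussianPDFReal, ← Real.exp_add]
  gcongr
  have hb : |x - m| ≤ R + |m| := (abs_sub x m).trans (by linarith)
  have hsq : (x - m) ^ 2 ≤ (R + |m|) ^ 2 := sq_le_sq' (by linarith [neg_abs_le (x - m)])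
    ((le_abs_self _).trans hb)
  rw [show (R + |m|) ^ 2 / (2 * v) + -(Real.pi ^ 2 / v) * (n : ℝ) ^ 2
    = ((R + |m|) ^ 2 - 2 * Real.pi ^ 2 * (n : ℝ) ^ 2) / (2 * v) by field_simp; ring]
  gcongr
  nlinarith [sq_nonneg (2 * (x - m) + n * (2 * Real.pi))]

lemma summable_gaussianPDFReal (m : ℝ) {v : NNReal} (hv : v ≠ 0) (x : ℝ) :
    Summable fun n : ℤ => gaussianPDFReal m v (x + n * (2 * Real.pi)) := by
  obtain ⟨u, hu, hb⟩ := exists_summable_bound_gaussianPDFReal m hv |x|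
  exact Summable.of_norm_bounded hu fun n => hb n x le_rfl

lemma continuous_wrappedPDF (m : ℝ) {v : NNReal} (hv : v ≠ 0) : Continuous (wrappedPDF m v) := by
  rw [continuous_iff_continuousAt]
  intro x
  obtain ⟨u, hu, hb⟩ := exists_summable_bound_gaussianPDFReal m hv (|x| + 1)
  have hc := continuous_gaussianPDFReal m v
  have : ContinuousOn (wrappedPDF m v) (Metric.closedBall x 1) := by
    refine continuousOn_tsum (fun n => by fun_prop) hu fun n y hy => hb n y ?_
    rw [Metric.mem_closedBall, Real.dist_eq] at hy
    linarith [abs_sub_abs_le_abs_sub y x]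
  exact this.continuousAt (Metric.closedBall_mem_nhds x one_pos)

/-- Folding an integral of a function of `cos` over the line onto one period. -/
lemma integral_gaussianPDFReal_mul_comp_cos (m : ℝ) {v : NNReal} (hv : v ≠ 0) {f : ℝ → ℝ}
    (hf : Continuous f) :
    ∫ x, gaussianPDFReal m v x * f (Real.cos x)
      = ∫ x in (-Real.pi)..Real.pi, wrappedPDF m v x * f (Real.cos x) := by
  have hπ : -Real.pi ≤ Real.pi := by linarith [Real.pi_pos]
  have hc := continuous_gaussianPDFReal m v
  obtain ⟨C, hC⟩ := (isCompact_Icc (a := (-1 : ℝ)) (b := 1)).exists_bound_of_continuousOn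
    hf.continuousOn
  have hC' : ∀ x, ‖f (Real.cos x)‖ ≤ C := fun x => hC _ (Real.cos_mem_Icc x)
  have hint : Integrable fun x => gaussianPDFReal m v x * f (Real.cos x) :=
    (integrable_gaussianPDFReal m v).mul_bdd (c := C)
      (Continuous.aestronglyMeasurable (by fun_prop)) (Eventually.of_forall hC')
  have hU := iUnion_Ioc_add_zsmul Real.two_pi_pos (-Real.pi)
  have hsum := hasSum_integral_iUnion (μ := volume) (fun n : ℤ => measurableSet_Ioc)
    (Set.pairwise_disjoint_Ioc_add_zsmul (-Real.pi) (2 * Real.pi))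
    (by rw [hU]; exact hint.integrableOn)
  rw [hU, setIntegral_univ] at hsum
  obtain ⟨u, hu, hb⟩ := exists_summable_bound_gaussianPDFReal m hv Real.pi
  have hsum' : HasSum (fun n : ℤ => ∫ x in (-Real.pi)..Real.pi,
      gaussianPDFReal m v (x + n * (2 * Real.pi)) * f (Real.cos x))
      (∫ x in (-Real.pi)..Real.pi, wrappedPDF m v x * f (Real.cos x)) := by
    refine intervalIntegral.hasSum_integral_of_dominated_convergence (fun n _ => u n * C)
      (fun n => Continuous.aestronglyMeasurable (by fun_prop))
      (fun n => Eventually.of_forall fun x hx => ?_)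
      (Eventually.of_forall fun x _ => hu.mul_right C) (by simp)
      (Eventually.of_forall fun x _ => (summable_gaussianPDFReal m hv x).hasSum.mul_right _)
    rw [Set.uIoc_of_le hπ] at hx
    rw [norm_mul]
    exact mul_le_mul (hb n x (abs_le.2 ⟨hx.1.le, hx.2⟩)) (hC' x) (norm_nonneg _)
      ((norm_nonneg _).trans (hb n x (abs_le.2 ⟨hx.1.le, hx.2⟩)))
  have hterm : ∀ n : ℤ, ∫ x in (-Real.pi)..Real.pi,
      gaussianPDFReal m v (x + n * (2 * Real.pi)) * f (Real.cos x)
      = ∫ x in Set.Ioc (-Real.pi + n • (2 * Real.pi)) (-Real.pi + (n + 1) • (2 * Real.pi)),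
        gaussianPDFReal m v x * f (Real.cos x) := fun n => by
    have h1 : -Real.pi + (n + 1) • (2 * Real.pi) = Real.pi + n * (2 * Real.pi) := by
      simp only [zsmul_eq_mul]; push_cast; ring
    have h2 : -Real.pi + n • (2 * Real.pi) = -Real.pi + n * (2 * Real.pi) := by
      rw [zsmul_eq_mul]
    rw [h1, h2, ← intervalIntegral.integral_of_le (by linarith),
      ← intervalIntegral.integral_comp_add_right]
    simp only [Real.cos_add_int_mul_two_pi]
  simp only [hterm] at hsum'
  exact hsum.unique hsum'

lemma integral_gaussianReal_comp_cos (m : ℝ) {v : NNReal} (hv : v ≠ 0) {f : ℝ → ℝ}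
    (hf : Continuous f) :
    ∫ x, f (Real.cos (m + x)) ∂(gaussianReal 0 v) = ∫ x in Set.Ioo (-1 : ℝ) 1,
      f x * ((wrappedPDF m v (Real.arccos x) + wrappedPDF m v (-Real.arccos x)) / √(1 - x ^ 2)) := by
  have hw := continuous_wrappedPDF m hv
  have h0 : ∫ x, f (Real.cos (m + x)) ∂(gaussianReal 0 v)
      = ∫ x, gaussianPDFReal m v x * f (Real.cos x) := by
    rw [integral_gaussianReal_eq_integral_smul hv,
      ← integral_add_left_eq_self (fun x => gaussianPDFReal m v x * f (Real.cos x)) m]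
    simp [gaussianPDFReal]
  rw [h0, integral_gaussianPDFReal_mul_comp_cos m hv hf,
    ← intervalIntegral.integral_add_adjacent_intervals (b := 0)
      (Continuous.intervalIntegrable (by fun_prop) _ _)
      (Continuous.intervalIntegrable (by fun_prop) _ _)]
  have h1 : ∫ x in (-Real.pi)..0, wrappedPDF m v x * f (Real.cos x)
      = ∫ x in 0..Real.pi, wrappedPDF m v (-x) * f (Real.cos x) := by
    have := intervalIntegral.integral_comp_neg (a := 0) (b := Real.pi)
      fun x => wrappedPDF m v x * f (Real.cos x)
    simpa using this.symm
  rw [h1, ← intervalIntegral.integral_add (Continuous.intervalIntegrable (by fun_prop) _ _)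
      (Continuous.intervalIntegrable (by fun_prop) _ _),
    intervalIntegral.integral_of_le Real.pi_pos.le, integral_Ioc_eq_integral_Ioo,
    ← image_cos_Ioo_zero_pi, integral_image_eq_integral_abs_deriv_smul measurableSet_Ioo
      (fun x _ => (Real.hasDerivAt_cos x).hasDerivWithinAt)
      (Real.injOn_cos.mono Set.Ioo_subset_Icc_self)]
  refine setIntegral_congr_fun measurableSet_Ioo fun x hx => ?_
  have hs := Real.sin_pos_of_mem_Ioo hx
  simp only [smul_eq_mul]
  rw [Real.arccos_cos hx.1.le hx.2.le, ← Real.sin_eq_sqrt_one_sub_cos_sq hx.1.le hx.2.le, abs_neg,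
    abs_of_pos hs]
  field_simp
  ring

lemma integrableOn_wrappedPDF_arccos (m : ℝ) {v : NNReal} (hv : v ≠ 0) :
    IntegrableOn (fun x => (wrappedPDF m v (Real.arccos x) + wrappedPDF m v (-Real.arccos x)) /
      √(1 - x ^ 2)) (Set.Ioo (-1) 1) := by
  have hw := continuous_wrappedPDF m hv
  rw [← image_cos_Ioo_zero_pi, integrableOn_image_iff_integrableOn_abs_deriv_smul measurableSet_Ioo
      (fun x _ => (Real.hasDerivAt_cos x).hasDerivWithinAt)
      (Real.injOn_cos.mono Set.Ioo_subset_Icc_self)]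
  have : IntegrableOn (fun x => wrappedPDF m v x + wrappedPDF m v (-x)) (Set.Ioo 0 Real.pi) :=
    (Continuous.integrableOn_Icc (by fun_prop)).mono_set Set.Ioo_subset_Icc_self
  refine this.congr_fun (fun x hx => ?_) measurableSet_Ioo
  have hs := Real.sin_pos_of_mem_Ioo hx
  simp only [smul_eq_mul]
  rw [Real.arccos_cos hx.1.le hx.2.le, ← Real.sin_eq_sqrt_one_sub_cos_sq hx.1.le hx.2.le, abs_neg,
    abs_of_pos hs]
  field_simp

lemma wrappedPDF_add_div_sin_eq_hfun {m : ℝ} (hm : m ∈ Set.Ioo 0 Real.pi) {v : NNReal}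
    (hv : v ≠ 0) :
    (wrappedPDF m v m + wrappedPDF m v (-m)) / Real.sin m = hfun m v := by
  have hv' : (0 : ℝ) < v := NNReal.coe_pos.2 (pos_iff_ne_zero.2 hv)
  have hs := Real.sin_pos_of_mem_Ioo hm
  have hsq : √(2 * Real.pi * v * Real.sin m ^ 2) = √(2 * Real.pi * v) * Real.sin m := by
    rw [Real.sqrt_mul (by positivity), Real.sqrt_sq hs.le]
  have hshift := (Equiv.addRight (1 : ℤ)).tsum_eq
    fun n : ℤ => gaussianPDFReal m v (-m + n * (2 * Real.pi))
  have hsum := (Equiv.addRight (1 : ℤ)).summable_iff.2 (summable_gaussianPDFReal m hv (-m))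
  simp only [Function.comp_def] at hsum
  unfold wrappedPDF
  rw [← hshift, ← (summable_gaussianPDFReal m hv m).tsum_add hsum, hfun, hsq, div_eq_inv_mul,
    ← tsum_mul_left, ← tsum_mul_left]
  refine tsum_congr fun n => ?_
  simp only [gaussianPDFReal, Equiv.coe_addRight]
  rw [show -(m + n * (2 * Real.pi) - m) ^ 2 / (2 * (v : ℝ)) = -2 * ((n : ℝ) * Real.pi) ^ 2 / v by
      field_simp; ring,
    show -(-m + ((n + 1 : ℤ) : ℝ) * (2 * Real.pi) - m) ^ 2 / (2 * (v : ℝ))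
      = -2 * (((n : ℝ) + 1) * Real.pi - m) ^ 2 / v by push_cast; field_simp; ring]
  field_simp

lemma tendsto_integral_fejer_gaussianReal {m : ℝ} (hm : m ∈ Set.Ioo 0 Real.pi) {v : NNReal}
    (hv : v ≠ 0) {G : ℝ → ℝ} (hG : Continuous G) :
    Tendsto (fun L : ℕ => ∫ ω, fejer L (Real.cos (m + ω) - Real.cos m) *
        G (Real.cos (m + ω) - Real.cos m) ∂(gaussianReal 0 v)) atTop
      (nhds (2 * G 0 * hfun m v)) := by
  have hcos : Real.cos m ∈ Set.Ioo (-1 : ℝ) 1 := image_cos_Ioo_zero_pi ▸ Set.mem_image_of_mem _ hm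
  have hs := Real.sin_pos_of_mem_Ioo hm
  have hw := continuous_wrappedPDF m hv
  have hsqrt : √(1 - Real.cos m ^ 2) = Real.sin m :=
    (Real.sin_eq_sqrt_one_sub_cos_sq hm.1.le hm.2.le).symm
  set D : ℝ → ℝ := fun x =>
    (wrappedPDF m v (Real.arccos x) + wrappedPDF m v (-Real.arccos x)) / √(1 - x ^ 2) with hD
  have hint : IntegrableOn (fun x => G (x - Real.cos m) * D x) (Set.Ioo (-1) 1) := by
    obtain ⟨C, hC⟩ := (isCompact_Icc (a := (-1 : ℝ)) (b := 1)).exists_bound_of_continuousOn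
      (f := fun x => G (x - Real.cos m)) (by fun_prop)
    refine (integrableOn_wrappedPDF_arccos m hv).bdd_mul (c := C)
      (Continuous.aestronglyMeasurable (by fun_prop)) ?_
    filter_upwards [ae_restrict_mem measurableSet_Ioo] with x hx
    exact hC x (Set.Ioo_subset_Icc_self hx)
  have hDcont : ContinuousAt D (Real.cos m) := by
    have := Real.continuous_arccos
    refine ContinuousAt.div (by fun_prop) (by fun_prop) ?_
    rw [hsqrt]
    exact hs.ne'
  have hDm : D (Real.cos m) = hfun m v := by
    simp only [hD]
    rw [hsqrt, Real.arccos_cos hm.1.le hm.2.le, wrappedPDF_add_div_sin_eq_hfun hm hv]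
  have key := tendsto_integral_fejer_mul hcos hint (by fun_prop)
  rw [sub_self, hDm, ← mul_assoc] at key
  refine key.congr fun L => ?_
  have hF := continuous_fejer L
  rw [integral_gaussianReal_comp_cos m hv
    (f := fun x => fejer L (x - Real.cos m) * G (x - Real.cos m)) (by fun_prop)]
  simp only [mul_assoc, hD]

/-- Proposition 2: the product of the two limiting expected beamforming gains — over the
azimuth error `ω_φ ~ N(0, σ_φ²)` and the elevation error `ω_ϕ ~ N(0, σ_ϕ²)` — equals
`4·M_t·h(φ, σ_φ²)·h(ϕ, σ_ϕ²)`. -/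
theorem stmt15 (φ ϕ σφ σϕ : ℝ) (hφ : φ ∈ Set.Ioo 0 Real.pi) (hϕ : ϕ ∈ Set.Ioo 0 Real.pi)
    (hσφ : 0 < σφ) (hσϕ : 0 < σϕ) (Mt : ℕ) (hMt : 1 ≤ Mt) :
    ∃ A B : ℝ,
      Tendsto (fun Lx : ℕ =>
          ∫ ω, fejer Lx (Real.cos (φ + ω) - Real.cos φ) *
              fejer Mt (Real.cos (φ + ω) - Real.cos φ)
            ∂(gaussianReal 0 ⟨σφ ^ 2, sq_nonneg σφ⟩)) atTop (nhds A) ∧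
      Tendsto (fun Ly : ℕ =>
          ∫ ω, fejer Ly (Real.cos (ϕ + ω) - Real.cos ϕ)
            ∂(gaussianReal 0 ⟨σϕ ^ 2, sq_nonneg σϕ⟩)) atTop (nhds B) ∧
      A * B = 4 * (Mt : ℝ) * hfun φ (σφ ^ 2) * hfun ϕ (σϕ ^ 2) := by
  have hv : ∀ σ : ℝ, 0 < σ → (⟨σ ^ 2, sq_nonneg σ⟩ : NNReal) ≠ 0 := fun σ hσ h =>
    (pow_pos hσ 2).ne' (congrArg NNReal.toReal h)
  have hx := tendsto_integral_fejer_gaussianReal hφ (hv σφ hσφ) (continuous_fejer Mt)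
  have hy := tendsto_integral_fejer_gaussianReal hϕ (hv σϕ hσϕ) (continuous_const (y := (1 : ℝ)))
  simp only [mul_one, fejer_zero_right] at hx hy
  refine ⟨_, _, hx, hy, ?_⟩
  change 2 * (Mt : ℝ) * hfun φ (σφ ^ 2) * (2 * hfun ϕ (σϕ ^ 2)) = _
  ring
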